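/- arXiv:1602.04031 — 5 statements merged into one kernel-verified Lean document; each statement's English description precedes it below -/
import Mathlib

section
/- For a natural number n, let E_n = (4/(n+1)) · Σ_{0 ≤ k < ℓ < ⌈n/2⌉} C(n,k)/C(n,ℓ) + [n even] · (1/(n+1)) · (2^n/C(n, n/2) − 1). Then for every natural number N ≥ 0, E_{2N+1} − E_{2N} = 0 and E_{2N+2} − E_{2N+1} = 1/(2N+3). -/
/-- `E_n = (4/(n+1)) · Σ_{0 ≤ k < ℓ < ⌈n/2⌉} C(n,k)/C(n,ℓ)
  + [n even]·(1/(n+1))·(2^n/C(n,n/2) − 1)`. -/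
def E (n : ℕ) : ℚ :=
  (4 / ((n : ℚ) + 1)) *
      (∑ l ∈ Finset.range ((n + 1) / 2), ∑ k ∈ Finset.range l,
        (n.choose k : ℚ) / (n.choose l : ℚ))
    + (if Even n then
        (1 / ((n : ℚ) + 1)) * ((2 : ℚ) ^ n / (n.choose (n / 2) : ℚ) - 1) else 0)

def aa (n l : ℕ) : ℚ := ∑ k ∈ Finset.range l, (n.choose k : ℚ) / (n.choose l : ℚ)

lemma aa_eq (n l : ℕ) : aa n l = (∑ k ∈ Finset.range l, (n.choose k : ℚ)) / (n.choose l : ℚ) := by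
  rw [aa, Finset.sum_div]

lemma choose_ne (n l : ℕ) (h : l ≤ n) : (n.choose l : ℚ) ≠ 0 := by
  exact_mod_cast (Nat.choose_pos h).ne'

lemma choose_r (n l : ℕ) (h : l ≤ n) :
    (n.choose (l+1) : ℚ) * (l + 1) = n.choose l * (n - l) := by
  have := Nat.choose_succ_right_eq n l
  rw [← Nat.cast_sub h]
  exact_mod_cast this

lemma aa_l (n l : ℕ) (h : l + 1 ≤ n) :
    ((n : ℚ) - l) * aa n (l+1) = (l + 1) * (aa n l + 1) := by
  rw [aa_eq, aa_eq, Finset.sum_range_succ]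
  have h1 := choose_ne n l (by omega)
  have h2 := choose_ne n (l+1) h
  have h3 := choose_r n l (by omega)
  field_simp
  linear_combination -h3

lemma S_succ (n l : ℕ) : (∑ k ∈ Finset.range (l+1), ((n+1).choose k : ℚ))
    = 2 * (∑ k ∈ Finset.range (l+1), (n.choose k : ℚ)) - n.choose l := by
  induction l with
  | zero => norm_num
  | succ l ih =>
    rw [Finset.sum_range_succ, ih, Finset.sum_range_succ _ (l+1), Nat.choose_succ_succ]
    push_cast
    ring

lemma aa_n (n l : ℕ) (h : l ≤ n) :
    ((n : ℚ) + 1) * aa (n+1) l = 2 * (n + 1 - l) * aa n l - l := by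
  cases l with
  | zero => simp [aa]
  | succ l =>
    rw [aa_eq, aa_eq, S_succ]
    have h1 := choose_ne n (l+1) h
    have h2 := choose_ne (n+1) (l+1) (by omega)
    have h3 := choose_r n l (by omega)
    have h4 : ((n+1).choose (l+1) : ℚ) = n.choose l + n.choose (l+1) := by
      rw [Nat.choose_succ_succ]; push_cast; ring
    have h5 : ((n+1).choose (l+1) : ℚ) * (n - l) = (n + 1) * n.choose (l+1) := by
      rw [h4]; linear_combination -h3
    have h6 : ((n+1).choose (l+1) : ℚ) * (l + 1) = (n + 1) * n.choose l := by
      rw [h4]; linear_combination h3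
    push_cast
    field_simp
    generalize (∑ k ∈ Finset.range (l+1), (n.choose k : ℚ)) = S
    linear_combination (-2 * S) * h5 + (n.choose (l+1) : ℚ) * h6

lemma T_rec (n m : ℕ) (h : m ≤ n) :
    ((n : ℚ) + 1) * ∑ l ∈ Finset.range m, aa (n+1) l
      = (n + 2) * (∑ l ∈ Finset.range m, aa n l) + m - (n + 1 - m) * aa n m := by
  induction m with
  | zero => simp [aa]
  | succ m ih =>
    have h1 := ih (by omega)
    have h2 := aa_l n m h
    have h3 := aa_n n m (by omega)
    rw [Finset.sum_range_succ, Finset.sum_range_succ]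
    push_cast
    linear_combination h1 + h2 + h3

lemma mid (N : ℕ) : (2 : ℚ) ^ (2 * N) / ((2*N).choose N : ℚ) - 1 = 2 * aa (2*N) N := by
  have h1 := choose_ne (2*N) N (by omega)
  have h : (2 : ℚ) ^ (2 * N) = 2 * (∑ k ∈ Finset.range N, ((2*N).choose k : ℚ)) + (2*N).choose N := by
    have h2 := S_succ (2*N) N
    have h3 : (∑ k ∈ Finset.range (N+1), ((2*N+1).choose k : ℚ)) = 4 ^ N := by
      exact_mod_cast Nat.sum_range_choose_halfway N
    rw [h3, Finset.sum_range_succ] at h2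
    rw [pow_mul]
    norm_num
    linear_combination h2
  rw [aa_eq, h]
  field_simp
  ring

lemma E_even (N : ℕ) : E (2*N) = (4 * (∑ l ∈ Finset.range N, aa (2*N) l) + 2 * aa (2*N) N) / (2 * N + 1) := by
  have h1 : (2 * N + 1) / 2 = N := by omega
  have h2 : 2 * N / 2 = N := by omega
  rw [E, h1, h2, mid, if_pos (by simp)]
  simp only [aa]
  push_cast
  ring

lemma E_odd (N : ℕ) : E (2*N+1) = 4 * (∑ l ∈ Finset.range (N+1), aa (2*N+1) l) / (2 * N + 2) := by
  have h1 : (2 * N + 1 + 1) / 2 = N + 1 := by omega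
  rw [E, h1, if_neg (by simp)]
  simp only [aa]
  push_cast
  ring

/-- For every `N ≥ 0`: `E_{2N+1} − E_{2N} = 0` and `E_{2N+2} − E_{2N+1} = 1/(2N+3)`. -/
theorem E_recurrence (N : ℕ) :
    E (2 * N + 1) - E (2 * N) = 0 ∧
    E (2 * N + 2) - E (2 * N + 1) = 1 / (2 * (N : ℚ) + 3) := by
  have p1 : (2 * (N : ℚ) + 1) ≠ 0 := by positivity
  have p2 : (2 * (N : ℚ) + 2) ≠ 0 := by positivity
  have p3 : (2 * (N : ℚ) + 3) ≠ 0 := by positivity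
  constructor
  · rw [E_even, E_odd, Finset.sum_range_succ, sub_eq_zero, div_eq_div_iff p2 p1]
    have h1 := T_rec (2*N) N (by omega)
    have h2 := aa_n (2*N) N (by omega)
    push_cast at h1 h2
    linear_combination 4 * h1 + 4 * h2
  · have e := E_even (N+1)
    rw [show 2 * (N + 1) = 2 * N + 2 by ring] at e
    have h1 := T_rec (2*N+1) (N+1) (by omega)
    have h2 := aa_n (2*N+1) (N+1) (by omega)
    rw [e, E_odd]
    push_cast at h1 h2 ⊢
    rw [show 2 * ((N : ℚ) + 1) + 1 = 2 * N + 3 by ring, div_sub_div _ _ p3 p2,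
      div_eq_div_iff (mul_ne_zero p3 p2) p3]
    linear_combination (2 * (N : ℚ) + 3) * (4 * h1 + 2 * h2)
end

section
/- For every natural number n ≥ 0, (1/(n+1)) · Σ_{ℓ=0}^{n} (1/C(n,ℓ)) · Σ_{w} #{ i : 0 ≤ i ≤ n, w_i = 0 } = H^odd_{n+1}, where the inner sum is over all lattice paths w of length n starting at height n−2ℓ. (This is the expected number of zeros Z_n of a random lattice path of length n.) -/
/-- The odd harmonic number `H^odd_n = ∑_{m=1}^n [m odd]/m`. -/
def Hodd (n : ℕ) : ℚ := ∑ m ∈ Finset.Icc 1 n, if Odd m then (1 : ℚ) / m else 0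

/-- The height after `i` steps of the walk starting at height `s` whose `j`-th step is
`+1` if `σ j = true` and `−1` if `σ j = false`. -/
def walk {n : ℕ} (s : ℤ) (σ : Fin n → Bool) (i : ℕ) : ℤ :=
  s + ∑ j : Fin n, if (j : ℕ) < i then (if σ j then 1 else -1) else 0

/-- The lattice paths of length `n` starting at height `s` (and ending at height `0`),
encoded by their step sequences. -/
def paths (n : ℕ) (s : ℤ) : Finset (Fin n → Bool) :=
  Finset.univ.filter (fun σ => walk s σ n = 0)

def ups {n : ℕ} (σ : Fin n → Bool) : ℕ := ∑ j : Fin n, if σ j then 1 else 0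

def wt (n u : ℕ) : ℚ := 1 / (((n : ℚ) + 1) * (n.choose u : ℚ))

def zer {n : ℕ} (σ : Fin n → Bool) : ℚ :=
  ∑ i ∈ Finset.range (n + 1), if walk ((n : ℤ) - 2 * (ups σ : ℤ)) σ i = 0 then 1 else 0

theorem sum_bool_succ {n : ℕ} (f : (Fin (n+1) → Bool) → ℚ) :
    ∑ σ, f σ = ∑ τ : Fin n → Bool, (f (Fin.cons true τ) + f (Fin.cons false τ)) := by
  rw [← (Fin.consEquiv (fun _ : Fin (n+1) => Bool)).sum_comp, Fintype.sum_prod_type]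
  simp [Fin.consEquiv, Finset.sum_add_distrib]

theorem ups_cons {n : ℕ} (b : Bool) (τ : Fin n → Bool) :
    ups (Fin.cons b τ : Fin (n+1) → Bool) = ups τ + (if b then 1 else 0) := by
  simp only [ups, Fin.sum_univ_succ, Fin.cons_zero, Fin.cons_succ]
  ring

theorem ups_le {n : ℕ} (σ : Fin n → Bool) : ups σ ≤ n := by
  unfold ups
  calc _ ≤ ∑ j : Fin n, 1 := Finset.sum_le_sum (fun j _ => by split_ifs <;> simp)
    _ = n := by simp

theorem walk_end {n : ℕ} (s : ℤ) (σ : Fin n → Bool) :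
    walk s σ n = s + 2 * (ups σ : ℤ) - n := by
  have : ∀ j : Fin n, (if (j : ℕ) < n then (if σ j then (1 : ℤ) else -1) else 0)
      = 2 * (if σ j then 1 else 0) - 1 := by
    intro j
    simp only [j.2, if_true]
    split_ifs <;> norm_num
  simp only [walk, ups, this, Finset.sum_sub_distrib, ← Finset.mul_sum]
  push_cast
  simp
  ring

theorem walk_zero {n : ℕ} (s : ℤ) (σ : Fin n → Bool) : walk s σ 0 = s := by
  simp [walk]

theorem walk_cons {n : ℕ} (s : ℤ) (b : Bool) (τ : Fin n → Bool) (i : ℕ) :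
    walk s (Fin.cons b τ : Fin (n+1) → Bool) (i+1)
      = walk (s + if b then 1 else -1) τ i := by
  simp [walk, Fin.sum_univ_succ, add_assoc]

theorem zer_cons {n : ℕ} (b : Bool) (τ : Fin n → Bool) :
    zer (Fin.cons b τ : Fin (n+1) → Bool) = zer τ +
      if n + 1 = 2 * ups (Fin.cons b τ : Fin (n+1) → Bool) then 1 else 0 := by
  unfold zer
  rw [Finset.sum_range_succ']
  congr 1
  · apply Finset.sum_congr rfl
    intro i _
    rw [walk_cons, ups_cons]
    have : ((n+1 : ℕ) : ℤ) - 2 * ((ups τ + (if b then 1 else 0) : ℕ) : ℤ)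
        + (if b then 1 else -1) = (n : ℤ) - 2 * (ups τ : ℤ) := by
      cases b <;> simp <;> ring
    rw [this]
  · rw [walk_zero]
    apply if_congr _ rfl rfl
    omega

theorem wt_rec (n u : ℕ) (h : u ≤ n) : wt (n+1) (u+1) + wt (n+1) u = wt n u := by
  unfold wt
  have h0 : (n.choose u : ℚ) ≠ 0 := by exact_mod_cast (Nat.choose_pos h).ne'
  have h1 : ((n+1).choose (u+1) : ℚ) ≠ 0 := by
    exact_mod_cast (Nat.choose_pos (by omega : u+1 ≤ n+1)).ne'
  have h2 : ((n+1).choose u : ℚ) ≠ 0 := by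
    exact_mod_cast (Nat.choose_pos (by omega : u ≤ n+1)).ne'
  obtain ⟨d, rfl⟩ := Nat.exists_eq_add_of_le h
  have e1 : ((u+d : ℕ) + 1 : ℚ) * ((u+d).choose u : ℚ)
      = ((u+d+1).choose (u+1) : ℚ) * (u+1) := by
    exact_mod_cast Nat.add_one_mul_choose_eq (u+d) u
  have e2 : ((u+d).choose u : ℚ) * ((u+d : ℕ) + 1) = ((u+d+1).choose u : ℚ) * (d+1) := by
    have := Nat.choose_mul_succ_eq (u+d) u
    rw [show u + d + 1 - u = d + 1 by omega] at this
    exact_mod_cast this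
  have hn : ((u+d : ℕ) : ℚ) + 1 ≠ 0 := by positivity
  have hu : (u : ℚ) + 1 ≠ 0 := by positivity
  have hd : (d : ℚ) + 1 ≠ 0 := by positivity
  replace e1 := (eq_div_iff hu).2 e1.symm
  replace e2 := (eq_div_iff hd).2 e2.symm
  rw [e1, e2]
  push_cast at *
  have h3 : (u : ℚ) + d + 1 + 1 ≠ 0 := by positivity
  field_simp
  ring

theorem count_ups (n k : ℕ) :
    ∑ σ : Fin n → Bool, (if ups σ = k then (1 : ℚ) else 0) = n.choose k := by
  induction n generalizing k with
  | zero => cases k <;> simp [ups]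
  | succ n ih =>
    rw [sum_bool_succ, Finset.sum_add_distrib]
    simp only [ups_cons]
    cases k with
    | zero => simpa using ih 0
    | succ k =>
      have a := ih k
      have b := ih (k+1)
      simp only [Nat.choose_succ_succ]
      push_cast
      rw [← a, ← b]
      simp

theorem bal_sum (n : ℕ) :
    ∑ σ : Fin n → Bool, wt n (ups σ) * (if n = 2 * ups σ then 1 else 0)
      = if Odd (n+1) then (1 : ℚ) / ((n+1 : ℕ) : ℚ) else 0 := by
  rcases Nat.even_or_odd' n with ⟨k, rfl | rfl⟩
  · have : ∀ σ : Fin (2*k) → Bool, wt (2*k) (ups σ) * (if 2*k = 2 * ups σ then 1 else 0)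
        = wt (2*k) k * (if ups σ = k then 1 else 0) := by
      intro σ
      by_cases h : ups σ = k
      · simp [h]
      · have : ¬ (k = ups σ) := fun h' => h h'.symm
        simp [h, this]
    rw [Finset.sum_congr rfl (fun σ _ => this σ), ← Finset.mul_sum, count_ups, if_pos ⟨k, rfl⟩]
    have h0 : ((2*k).choose k : ℚ) ≠ 0 := by
      exact_mod_cast (Nat.choose_pos (by omega : k ≤ 2*k)).ne'
    have h1 : (2 * (k:ℚ) + 1) ≠ 0 := by positivity
    unfold wt
    push_cast
    field_simp
  · rw [if_neg (by rw [Nat.not_odd_iff_even]; exact ⟨k+1, by ring⟩)]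
    apply Finset.sum_eq_zero
    intro σ _
    rw [if_neg (by omega), mul_zero]

theorem main_sum (n : ℕ) :
    ∑ σ : Fin n → Bool, wt n (ups σ) * zer σ = Hodd (n+1) := by
  induction n with
  | zero => simp [wt, zer, ups, walk, Hodd]
  | succ n ih =>
    have hH : Hodd (n+1+1) = Hodd (n+1) +
        if Odd (n+1+1) then (1 : ℚ) / ((n+1+1 : ℕ) : ℚ) else 0 := by
      unfold Hodd
      rw [Finset.sum_Icc_succ_top (by omega)]
    rw [hH, ← bal_sum (n+1), ← ih, sum_bool_succ, sum_bool_succ, ← Finset.sum_add_distrib]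
    apply Finset.sum_congr rfl
    intro τ _
    rw [← wt_rec n _ (ups_le τ), zer_cons, zer_cons]
    simp only [ups_cons, if_true, Bool.false_eq_true, if_false, add_zero]
    ring

/-- The expected number of zeros of a random lattice path of length `n` (starting height
uniform on `{−n, −n+2, …, n}`, then the path uniform among all paths from that height)
is `H^odd_{n+1}`. -/
theorem expected_zeros (n : ℕ) :
    (1 / ((n : ℚ) + 1)) *
        ∑ l ∈ Finset.range (n + 1),
          (1 / (n.choose l : ℚ)) *
            ∑ σ ∈ paths n ((n : ℤ) - 2 * l),
              (((Finset.range (n + 1)).filter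
                (fun i => walk ((n : ℤ) - 2 * l) σ i = 0)).card : ℚ)
      = Hodd (n + 1) := by
  rw [← main_sum n, Finset.mul_sum]
  have : ∀ l ∈ Finset.range (n+1), (1 / ((n : ℚ) + 1)) * ((1 / (n.choose l : ℚ)) *
            ∑ σ ∈ paths n ((n : ℤ) - 2 * l),
              (((Finset.range (n + 1)).filter
                (fun i => walk ((n : ℤ) - 2 * l) σ i = 0)).card : ℚ))
      = ∑ σ : Fin n → Bool, if ups σ = l then wt n (ups σ) * zer σ else 0 := by
    intro l _
    rw [← mul_assoc, Finset.mul_sum, paths, Finset.sum_filter]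
    apply Finset.sum_congr rfl
    intro σ _
    rw [walk_end]
    by_cases h : ups σ = l
    · subst h
      rw [if_pos (by ring), if_pos rfl]
      simp [wt, zer, mul_comm]
    · rw [if_neg (by omega), if_neg h]
  rw [Finset.sum_congr rfl this, Finset.sum_comm]
  apply Finset.sum_congr rfl
  intro σ _
  rw [Finset.sum_ite_eq, if_pos (by have := ups_le σ; simp; omega)]
end

section
/- For every natural number n ≥ 2: (a) (1/(2·C(n,2))) · Σ_{n'=0}^{n−2} (n'+1) · H^odd_{n'} = (1/2)·H^odd_{n−2} − 1/8 + (−1)^n/(8·(n − [n even])); and (b) (1/(2·C(n,2))) · Σ_{n'=0}^{n−2} (n'+1) · (H^odd_{n'+1} − 1) = (1/2)·H^odd_{n−2} − 5/8 + (−1)^n/(8·(n − [n even])) + 1/(2·(n − [n even])). (These are the exact expected numbers E[X^↗_n] of up-to-zero situations and E[X^↘_n] of down-from-zero situations for lattice paths of variable length, where the path length N' = n − 1 − (Q − P) comes from a uniformly random pair 1 ≤ P < Q ≤ n, noting that P(N' = n') = (n'+1)/C(n,2) and that a random lattice path of length n' has expected number (1/2)·H^odd_{n'} of up-to-zero and (1/2)·(H^odd_{n'+1}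 − 1) of down-from-zero situations.) -/
lemma Hodd_odd (k : ℕ) : Hodd (2*k+1) = Hodd (2*k) + 1/(2*(k:ℚ)+1) := by
  unfold Hodd
  rw [Finset.sum_Icc_succ_top (by omega), if_pos ⟨k, rfl⟩]
  push_cast
  rfl

lemma Hodd_even (k : ℕ) : Hodd (2*k+2) = Hodd (2*k+1) := by
  unfold Hodd
  rw [Finset.sum_Icc_succ_top (by omega : 1 ≤ 2*k+1+1), if_neg (by
    rw [Nat.not_odd_iff_even]; exact ⟨k+1, by ring⟩)]
  simp

lemma sum_a (k : ℕ) : ∑ m ∈ Finset.range (2*k+1), ((m : ℚ) + 1) * Hodd m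
    = (2*k+2)*(2*k+1)*(Hodd (2*k)/2 - 1/8) + (2*k+2)/8 := by
  induction k with
  | zero => simp [Hodd]; norm_num
  | succ k ih =>
    have e : 2*(k+1)+1 = 2*k+1+1+1 := by ring
    have e2 : 2*(k+1) = 2*k+2 := by ring
    have hk : (2*(k:ℚ)+1) ≠ 0 := by positivity
    rw [e, Finset.sum_range_succ, Finset.sum_range_succ, ih, e2, Hodd_even, Hodd_odd]
    push_cast
    field_simp
    ring

lemma sum_b (k : ℕ) : ∑ m ∈ Finset.range (2*k+1), ((m : ℚ) + 1) * (Hodd (m+1) - 1)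
    = (2*k+2)*(2*k+1)*(Hodd (2*k)/2 - 5/8) + (2*k+2)/8 + (2*k+2)/2 := by
  induction k with
  | zero => simp [Hodd]; norm_num
  | succ k ih =>
    have e : 2*(k+1)+1 = 2*k+1+1+1 := by ring
    have e2 : 2*(k+1) = 2*k+2 := by ring
    have e3 : 2*k+1+1+1 = 2*(k+1)+1 := by ring
    have hk : (2*(k:ℚ)+1) ≠ 0 := by positivity
    have hk2 : (2*((k:ℚ)+1)+1) ≠ 0 := by positivity
    rw [e, Finset.sum_range_succ, Finset.sum_range_succ, ih, e3, Hodd_odd, e2, Hodd_even, Hodd_odd]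
    push_cast
    field_simp
    ring

/-- Exact expected numbers of up-to-zero resp. down-from-zero situations in the
variable-length lattice path model: for `n ≥ 2`,
(a) `(1/(2·C(n,2)))·Σ_{n'=0}^{n−2} (n'+1)·H^odd_{n'}
      = (1/2)·H^odd_{n−2} − 1/8 + (−1)^n/(8(n−[n even]))`, and
(b) `(1/(2·C(n,2)))·Σ_{n'=0}^{n−2} (n'+1)·(H^odd_{n'+1} − 1)
      = (1/2)·H^odd_{n−2} − 5/8 + (−1)^n/(8(n−[n even])) + 1/(2(n−[n even]))`. -/
theorem variable_length_expectations (n : ℕ) (h : 2 ≤ n) :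
    ((1 / (2 * (n.choose 2 : ℚ))) *
        ∑ m ∈ Finset.range (n - 1), ((m : ℚ) + 1) * Hodd m
      = (1 / 2) * Hodd (n - 2) - 1 / 8
        + (-1 : ℚ) ^ n / (8 * ((n : ℚ) - if Even n then 1 else 0))) ∧
    ((1 / (2 * (n.choose 2 : ℚ))) *
        ∑ m ∈ Finset.range (n - 1), ((m : ℚ) + 1) * (Hodd (m + 1) - 1)
      = (1 / 2) * Hodd (n - 2) - 5 / 8
        + (-1 : ℚ) ^ n / (8 * ((n : ℚ) - if Even n then 1 else 0))
        + 1 / (2 * ((n : ℚ) - if Even n then 1 else 0))) := by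
  have hn : ∃ k, n = 2*k+2 ∨ n = 2*k+3 := ⟨(n-2)/2, by omega⟩
  obtain ⟨k, rfl | rfl⟩ := hn
  · have hk : (2*(k:ℚ)+1) ≠ 0 := by positivity
    have hk2 : (2*(k:ℚ)+2) ≠ 0 := by positivity
    have ev : Even (2*k+2) := ⟨k+1, by ring⟩
    have e1 : 2*k+2-1 = 2*k+1 := by omega
    have e2 : 2*k+2-2 = 2*k := by omega
    have e3 : (2*(k:ℚ)+2-1) = 2*k+1 := by ring
    rw [e1, e2, sum_a, sum_b, Nat.cast_choose_two, ev.neg_one_pow, if_pos ev]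
    push_cast
    rw [e3]
    constructor <;> field_simp <;> ring
  · have hk : (2*(k:ℚ)+1) ≠ 0 := by positivity
    have hk2 : (2*(k:ℚ)+2) ≠ 0 := by positivity
    have hk3 : (2*(k:ℚ)+3) ≠ 0 := by positivity
    have od : Odd (2*k+3) := ⟨k+1, by ring⟩
    have e1 : 2*k+3-1 = 2*k+1+1 := by omega
    have e2 : 2*k+3-2 = 2*k+1 := by omega
    have e3 : (2*(k:ℚ)+3-1) = 2*k+2 := by ring
    rw [e1, e2, Finset.sum_range_succ _ (2*k+1), Finset.sum_range_succ _ (2*k+1), sum_a, sum_b, Nat.cast_choose_two,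
      od.neg_one_pow, if_neg (Nat.not_even_iff_odd.mpr od), Hodd_even, Hodd_odd]
    push_cast
    rw [e3, sub_zero]
    constructor <;> field_simp <;> ring
end

section
/- For every natural number n ≥ 2, (1/C(n,2)) · Σ_{1 ≤ p < q ≤ n} min(p−1, n−q) = n/6 − 7/12 + 1/(4·(n − [n even])). -/
def auxT (n : ℕ) : ℚ :=
  ∑ q ∈ Finset.range n, ∑ p ∈ Finset.range q, ((min p (n - 1 - q) : ℕ) : ℚ)

lemma auxT_succ (n : ℕ) : auxT (n + 2) = auxT n + (n : ℚ) * (n - 1) / 2 := by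
  have hs : ∀ m : ℕ, ∑ q ∈ Finset.range m, (q : ℚ) = (m : ℚ) * (m - 1) / 2 := by
    intro m
    induction m with
    | zero => simp
    | succ k ih => rw [Finset.sum_range_succ, ih]; push_cast; ring
  rw [← hs n]
  unfold auxT
  rw [Finset.sum_range_succ, Finset.sum_range_succ', ← Finset.sum_add_distrib]
  have h0 : ∑ p ∈ Finset.range (n + 1), ((min p (n + 2 - 1 - (n + 1)) : ℕ) : ℚ) = 0 := by
    apply Finset.sum_eq_zero
    intro p _
    simp
  rw [h0]
  simp only [Finset.range_zero, Finset.sum_empty, add_zero]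
  apply Finset.sum_congr rfl
  intro q hq
  have hq' := Finset.mem_range.1 hq
  rw [Finset.sum_range_succ']
  have h1 : ∀ p : ℕ, ((min (p + 1) (n + 2 - 1 - (q + 1)) : ℕ) : ℚ)
      = ((min p (n - 1 - q) : ℕ) : ℚ) + 1 := by
    intro p
    have : min (p + 1) (n + 2 - 1 - (q + 1)) = min p (n - 1 - q) + 1 := by omega
    rw [this]; push_cast; ring
  simp only [h1, Finset.sum_add_distrib]
  simp

lemma auxT_even (k : ℕ) : auxT (2 * k) = (k : ℚ) * (k - 1) * (4 * k - 5) / 6 := by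
  induction k with
  | zero => simp [auxT]
  | succ k ih =>
    rw [show 2 * (k + 1) = 2 * k + 2 by ring, auxT_succ, ih]; push_cast; ring

lemma auxT_odd (k : ℕ) : auxT (2 * k + 1) = (k : ℚ) * (k - 1) * (4 * k + 1) / 6 := by
  induction k with
  | zero => simp [auxT]
  | succ k ih =>
    rw [show 2 * (k + 1) + 1 = 2 * k + 1 + 2 by ring, auxT_succ, ih]; push_cast; ring

lemma sum_Icc_shift (f : ℕ → ℚ) (m : ℕ) :
    ∑ q ∈ Finset.Icc 1 m, f q = ∑ q ∈ Finset.range m, f (q + 1) := by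
  induction m with
  | zero => simp
  | succ k ih => rw [Finset.sum_Icc_succ_top (by omega), ih, Finset.sum_range_succ]

/-- For `n ≥ 2`,
`(1/C(n,2)) · Σ_{1 ≤ p < q ≤ n} min(p−1, n−q) = n/6 − 7/12 + 1/(4(n−[n even]))`. -/
theorem average_min_identity (n : ℕ) (h : 2 ≤ n) :
    (1 / (n.choose 2 : ℚ)) *
        ∑ q ∈ Finset.Icc 1 n, ∑ p ∈ Finset.Icc 1 (q - 1),
          ((min (p - 1) (n - q) : ℕ) : ℚ)
      = (n : ℚ) / 6 - 7 / 12 + 1 / (4 * ((n : ℚ) - if Even n then 1 else 0)) := by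
  have hT : ∑ q ∈ Finset.Icc 1 n, ∑ p ∈ Finset.Icc 1 (q - 1),
          ((min (p - 1) (n - q) : ℕ) : ℚ) = auxT n := by
    rw [sum_Icc_shift]
    unfold auxT
    apply Finset.sum_congr rfl
    intro q _
    rw [sum_Icc_shift]
    apply Finset.sum_congr (by simp)
    intro p _
    congr 2
    omega
  rw [hT, Nat.cast_choose_two]
  rcases Nat.even_or_odd' n with ⟨k, rfl | rfl⟩
  · have hk : (1 : ℚ) ≤ k := by exact_mod_cast (by omega : 1 ≤ k)
    rw [auxT_even, if_pos (even_two_mul k)]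
    push_cast
    have h1 : (k : ℚ) ≠ 0 := by linarith
    have h2 : 2 * (k : ℚ) - 1 ≠ 0 := by linarith
    field_simp
    ring
  · have hk : (1 : ℚ) ≤ k := by exact_mod_cast (by omega : 1 ≤ k)
    rw [auxT_odd, if_neg (by simp)]
    push_cast
    have h1 : (k : ℚ) ≠ 0 := by linarith
    have h2 : 2 * (k : ℚ) + 1 ≠ 0 := by linarith
    rw [add_sub_cancel_right, sub_zero]
    field_simp
    ring
end

section
/- Let ε_n = [n even]. For n ≥ 2 define the partitioning cost of the comparison-optimal dual-pivot quicksort strategy 'Clairvoyant' by p_n = (3/2)n − 9/4 + 1/(4(n − ε_n)) − x_n, where x_n = (1/2)·H^odd_{n−2} − 5/8 + (−1)^n/(8(n − ε_n)) + 1/(2(n − ε_n)). Define c : ℕ → ℚ by c_0 = c_1 = 0 and, for n ≥ 2, by the dual-pivot quicksort recurrence c_n = p_n + (3/C(n,2)) · Σ_{k=1}^{n−2} (n−1−k) · c_k. Then for every n ≥ 4, c_n = (9/5)·n·H_n + (1/5)·n·H^alt_n − (89/25)·n + (77/40)·H_n + (3/40)·H^alt_n + 67/800 − (−1)^n/10 +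 r_n, where r_n = ([n even]/320)·(1/(n−3) + 3/(n−1)) − ([n odd]/320)·(3/(n−2) + 1/n). -/
/-- The harmonic number `H_n = ∑_{m=1}^n 1/m`. -/
def H (n : ℕ) : ℚ := ∑ m ∈ Finset.Icc 1 n, (1 : ℚ) / m

/-- The alternating harmonic number `H^alt_n = ∑_{m=1}^n (−1)^m/m`. -/
def Halt (n : ℕ) : ℚ := ∑ m ∈ Finset.Icc 1 n, (-1 : ℚ) ^ m / m

/-- `ε_n = [n even]`. -/
def eps (n : ℕ) : ℚ := if Even n then 1 else 0

/-- `x_n = E[X^↘_n]`, the expected number of down-from-zero situations. -/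
def x (n : ℕ) : ℚ :=
  (1 / 2) * Hodd (n - 2) - 5 / 8 + (-1 : ℚ) ^ n / (8 * ((n : ℚ) - eps n))
    + 1 / (2 * ((n : ℚ) - eps n))

/-- Partitioning cost of strategy "Clairvoyant". -/
def p (n : ℕ) : ℚ := (3 / 2) * (n : ℚ) - 9 / 4 + 1 / (4 * ((n : ℚ) - eps n)) - x n

/-- The remainder term `r_n`. -/
def r (n : ℕ) : ℚ :=
  (if Even n then (1 : ℚ) / 320 else 0) * (1 / ((n : ℚ) - 3) + 3 / ((n : ℚ) - 1))
    - (if Odd n then (1 : ℚ) / 320 else 0) * (3 / ((n : ℚ) - 2) + 1 / (n : ℚ))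


lemma H_succ (n : ℕ) : H (n + 1) = H n + 1 / ((n : ℚ) + 1) := by
  unfold H
  rw [Finset.sum_Icc_succ_top (by omega)]
  push_cast
  rfl

lemma Halt_succ (n : ℕ) : Halt (n + 1) = Halt n + (-1 : ℚ) ^ (n + 1) / ((n : ℚ) + 1) := by
  unfold Halt
  rw [Finset.sum_Icc_succ_top (by omega)]
  push_cast
  rfl

lemma Hodd_succ (n : ℕ) :
    Hodd (n + 1) = Hodd n + if Odd (n + 1) then 1 / ((n : ℚ) + 1) else 0 := by
  unfold Hodd
  rw [Finset.sum_Icc_succ_top (by omega)]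
  push_cast
  rfl

lemma Hodd_eq (n : ℕ) : Hodd n = (H n - Halt n) / 2 := by
  induction n with
  | zero => simp [Hodd, H, Halt]
  | succ n ih =>
    rw [Hodd_succ, H_succ, Halt_succ, ih]
    by_cases h : Odd (n + 1)
    · rw [h.neg_one_pow, if_pos h]; ring
    · rw [(Nat.not_odd_iff_even.mp h).neg_one_pow, if_neg h]; ring

def TT (c : ℕ → ℚ) (n : ℕ) : ℚ := ∑ k ∈ Finset.Icc 1 n, ((n : ℚ) + 1 - k) * c k

lemma TT_succ (c : ℕ → ℚ) (n : ℕ) :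
    TT c (n + 1) = TT c n + ∑ k ∈ Finset.Icc 1 (n + 1), c k := by
  unfold TT
  rw [Finset.sum_Icc_succ_top (by omega), Finset.sum_Icc_succ_top (by omega), ← add_assoc,
    ← Finset.sum_add_distrib]
  congr 1
  · apply Finset.sum_congr rfl
    intro k _
    push_cast
    ring
  · push_cast
    ring

lemma TT_rec (c : ℕ → ℚ) (n : ℕ) :
    TT c (n + 2) = 2 * TT c (n + 1) - TT c n + c (n + 2) := by
  have h1 := TT_succ c n
  have h2 := TT_succ c (n + 1)
  rw [Finset.sum_Icc_succ_top (by omega)] at h2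
  linarith

lemma rec_TT (c : ℕ → ℚ) (hrec : ∀ n, 2 ≤ n →
      c n = p n + (3 / (n.choose 2 : ℚ)) *
        ∑ k ∈ Finset.Icc 1 (n - 2), ((n - 1 - k : ℕ) : ℚ) * c k) (n : ℕ) :
    TT c n = ((n : ℚ) + 2) * (n + 1) / 6 * (c (n + 2) - p (n + 2)) := by
  have h := hrec (n + 2) (by omega)
  have e : ∑ k ∈ Finset.Icc 1 (n + 2 - 2), ((n + 2 - 1 - k : ℕ) : ℚ) * c k = TT c n := by
    unfold TT
    apply Finset.sum_congr rfl
    intro k hk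
    have := (Finset.mem_Icc.mp hk).2
    have e2 : n + 2 - 1 - k = n + 1 - k := by omega
    rw [e2, Nat.cast_sub (by omega)]
    push_cast
    rfl
  rw [e, Nat.cast_choose_two] at h
  rw [h]
  push_cast
  have a1 : (n : ℚ) + 2 ≠ 0 := by positivity
  have a2 : (n : ℚ) + 1 ≠ 0 := by positivity
  have a3 : (n : ℚ) + 2 - 1 ≠ 0 := by
    have : (n : ℚ) + 2 - 1 = n + 1 := by ring
    rw [this]; exact a2
  field_simp
  ring

lemma step (c : ℕ → ℚ) (hrec : ∀ n, 2 ≤ n →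
      c n = p n + (3 / (n.choose 2 : ℚ)) *
        ∑ k ∈ Finset.Icc 1 (n - 2), ((n - 1 - k : ℕ) : ℚ) * c k) (n : ℕ) :
    c (n + 4) = p (n + 4) + (2 * ((n : ℚ) + 3) * (n + 2) * (c (n + 3) - p (n + 3))
      - (n + 2) * (n + 1) * (c (n + 2) - p (n + 2)) + 6 * c (n + 2)) / ((n + 4) * (n + 3)) := by
  have h0 := rec_TT c hrec n
  have h1 := rec_TT c hrec (n + 1)
  have h2 := rec_TT c hrec (n + 2)
  have h := TT_rec c n
  rw [h0, h1, h2] at h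
  push_cast at h
  simp only [add_assoc] at h
  norm_num at h
  have a1 : (n : ℚ) + 4 ≠ 0 := by positivity
  have a2 : (n : ℚ) + 3 ≠ 0 := by positivity
  field_simp
  linarith

def ff (n : ℕ) : ℚ := (9 / 5) * (n : ℚ) * H n + (1 / 5) * (n : ℚ) * Halt n - (89 / 25) * (n : ℚ)
        + (77 / 40) * H n + (3 / 40) * Halt n + 67 / 800 - (-1 : ℚ) ^ n / 10 + r n

lemma ff_step (j : ℕ) : ff (j + 6) = p (j + 6) +
    (2 * ((j : ℚ) + 5) * (j + 4) * (ff (j + 5) - p (j + 5))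
      - (j + 4) * (j + 3) * (ff (j + 4) - p (j + 4)) + 6 * ff (j + 4)) / ((j + 6) * (j + 5)) := by
  have b1 : (j : ℚ) + 1 ≠ 0 := by positivity
  have b2 : (j : ℚ) + 2 ≠ 0 := by positivity
  have b3 : (j : ℚ) + 3 ≠ 0 := by positivity
  have b4 : (j : ℚ) + 4 ≠ 0 := by positivity
  have b5 : (j : ℚ) + 5 ≠ 0 := by positivity
  have b6 : (j : ℚ) + 6 ≠ 0 := by positivity
  have H3 := H_succ (j + 2)
  have H4 := H_succ (j + 3)
  have H5 := H_succ (j + 4)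
  have H6 := H_succ (j + 5)
  have A3 := Halt_succ (j + 2)
  have A4 := Halt_succ (j + 3)
  have A5 := Halt_succ (j + 4)
  have A6 := Halt_succ (j + 5)
  simp only [add_assoc] at H3 H4 H5 H6 A3 A4 A5 A6
  push_cast at H3 H4 H5 H6 A3 A4 A5 A6
  norm_num [add_assoc] at H3 H4 H5 H6 A3 A4 A5 A6
  have s6 : j + 6 - 2 = j + 4 := by omega
  have s5 : j + 5 - 2 = j + 3 := by omega
  have s4 : j + 4 - 2 = j + 2 := by omega
  have t63 : (j : ℚ) + 6 - 3 = j + 3 := by ring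
  have t61 : (j : ℚ) + 6 - 1 = j + 5 := by ring
  have t62 : (j : ℚ) + 6 - 2 = j + 4 := by ring
  have t53 : (j : ℚ) + 5 - 3 = j + 2 := by ring
  have t51 : (j : ℚ) + 5 - 1 = j + 4 := by ring
  have t52 : (j : ℚ) + 5 - 2 = j + 3 := by ring
  have t43 : (j : ℚ) + 4 - 3 = j + 1 := by ring
  have t41 : (j : ℚ) + 4 - 1 = j + 3 := by ring
  have t42 : (j : ℚ) + 4 - 2 = j + 2 := by ring
  rcases Nat.even_or_odd j with hj | hj
  · have e4 : Even (j + 4) := by grind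
    have e5 : Odd (j + 5) := by grind
    have e6 : Even (j + 6) := by grind
    have e3 : Odd (j + 3) := by grind
    have n4 := Nat.not_odd_iff_even.mpr e4
    have n5 := Nat.not_even_iff_odd.mpr e5
    have n6 := Nat.not_odd_iff_even.mpr e6
    rw [e3.neg_one_pow] at A3
    rw [e4.neg_one_pow] at A4
    rw [e5.neg_one_pow] at A5
    rw [e6.neg_one_pow] at A6
    unfold ff p x r eps
    rw [s6, s5, s4]
    simp only [Hodd_eq, e4.neg_one_pow, e5.neg_one_pow, e6.neg_one_pow, if_pos e4, if_pos e5,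
      if_pos e6, if_neg n4, if_neg n5, if_neg n6]
    rw [H6, H5, H4, H3, A6, A5, A4, A3]
    push_cast
    simp only [t63, t61, t62, t53, t51, t52, t43, t41, t42, sub_zero, zero_mul, zero_sub]
    generalize H (j + 2) = h
    generalize Halt (j + 2) = a
    field_simp
    ring
  · have e4 : Odd (j + 4) := by grind
    have e5 : Even (j + 5) := by grind
    have e6 : Odd (j + 6) := by grind
    have e3 : Even (j + 3) := by grind
    have n4 := Nat.not_even_iff_odd.mpr e4
    have n5 := Nat.not_odd_iff_even.mpr e5
    have n6 := Nat.not_even_iff_odd.mpr e6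
    rw [e3.neg_one_pow] at A3
    rw [e4.neg_one_pow] at A4
    rw [e5.neg_one_pow] at A5
    rw [e6.neg_one_pow] at A6
    unfold ff p x r eps
    rw [s6, s5, s4]
    simp only [Hodd_eq, e4.neg_one_pow, e5.neg_one_pow, e6.neg_one_pow, if_pos e4, if_pos e5,
      if_pos e6, if_neg n4, if_neg n5, if_neg n6]
    rw [H6, H5, H4, H3, A6, A5, A4, A3]
    push_cast
    simp only [t63, t61, t62, t53, t51, t52, t43, t41, t42, sub_zero, zero_mul, zero_sub]
    generalize H (j + 2) = h
    generalize Halt (j + 2) = a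
    field_simp
    ring

lemma H_zero : H 0 = 0 := by simp [H]
lemma Halt_zero : Halt 0 = 0 := by simp [Halt]

lemma base (c : ℕ → ℚ) (h1 : c 1 = 0) (hrec : ∀ n, 2 ≤ n →
      c n = p n + (3 / (n.choose 2 : ℚ)) *
        ∑ k ∈ Finset.Icc 1 (n - 2), ((n - 1 - k : ℕ) : ℚ) * c k) :
    c 4 = ff 4 ∧ c 5 = ff 5 := by
  have P2 : p 2 = 1 := by decide +kernel
  have P3 : p 3 = 7/3 := by decide +kernel
  have P4 : p 4 = 15/4 := by decide +kernel
  have P5 : p 5 = 311/60 := by decide +kernel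
  have F4 : ff 4 = 17/4 := by decide +kernel
  have F5 : ff 5 = 389/60 := by decide +kernel
  have c2 := hrec 2 (by omega)
  have c3 := hrec 3 (by omega)
  have c4 := step c hrec 0
  have c5 := step c hrec 1
  norm_num [h1, Finset.sum_Icc_succ_top, P2, P3, P4, P5, Nat.choose] at c2 c3 c4 c5
  rw [c2, c3] at c4
  rw [c4, c3] at c5
  constructor
  · rw [F4, c4]; norm_num
  · rw [F5, c5]; norm_num

lemma main (c : ℕ → ℚ) (h1 : c 1 = 0) (hrec : ∀ n, 2 ≤ n →
      c n = p n + (3 / (n.choose 2 : ℚ)) *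
        ∑ k ∈ Finset.Icc 1 (n - 2), ((n - 1 - k : ℕ) : ℚ) * c k) (j : ℕ) :
    c (j + 4) = ff (j + 4) ∧ c (j + 5) = ff (j + 5) := by
  induction j with
  | zero => exact base c h1 hrec
  | succ j ih =>
    have e5 : j + 1 + 4 = j + 5 := by omega
    have e6 : j + 1 + 5 = j + 6 := by omega
    rw [e5, e6]
    refine ⟨ih.2, ?_⟩
    have h := step c hrec (j + 2)
    have i4 : j + 2 + 2 = j + 4 := by omega
    have i5 : j + 2 + 3 = j + 5 := by omega
    have i6 : j + 2 + 4 = j + 6 := by omega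
    rw [i4, i5, i6, ih.1, ih.2] at h
    rw [ff_step, h]
    push_cast
    ring

/-- The exact average number of comparisons of the comparison-optimal dual-pivot
quicksort algorithm "Clairvoyant": if `c` satisfies `c_0 = c_1 = 0` and the dual-pivot
quicksort recurrence `c_n = p_n + (3/C(n,2))·Σ_{k=1}^{n−2}(n−1−k)·c_k` for `n ≥ 2`, then
for `n ≥ 4`,
`c_n = (9/5)nH_n + (1/5)nH^alt_n − (89/25)n + (77/40)H_n + (3/40)H^alt_n
  + 67/800 − (−1)^n/10 + r_n`. -/
theorem clairvoyant_cost (c : ℕ → ℚ) (h0 : c 0 = 0) (h1 : c 1 = 0)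
    (hrec : ∀ n, 2 ≤ n →
      c n = p n + (3 / (n.choose 2 : ℚ)) *
        ∑ k ∈ Finset.Icc 1 (n - 2), ((n - 1 - k : ℕ) : ℚ) * c k) :
    ∀ n, 4 ≤ n →
      c n = (9 / 5) * (n : ℚ) * H n + (1 / 5) * (n : ℚ) * Halt n - (89 / 25) * (n : ℚ)
        + (77 / 40) * H n + (3 / 40) * Halt n + 67 / 800 - (-1 : ℚ) ^ n / 10 + r n := by
  intro n hn
  obtain ⟨j, rfl⟩ := Nat.exists_eq_add_of_le' hn
  exact (main c h1 hrec j).1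
end
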